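/- Correctness of an arbitrary sequence of delegations: fix a commutative group G, g : G, an integer sk, n : ℕ, and initial data w, ρ : Fin n → ℤ. Let D be a list of delegations, each a triple (j, t, r) with j : Fin n, t : ℤ, r : Fin n → ℤ, and let vec(j, t, r) : Fin n → G × G be the one-hot encrypted vector k ↦ Enc(g^sk, if k = j then t else 0, r k). Let L : Fin n → G × G be the result of starting from k ↦ Enc(g^sk, w k, ρ k) and folding componentwise homomorphic addition Add of vec(j, t, r) over all (j, t, r) in D. Then for every k : Fin n, Dec(sk, L k) = g^(w k + ∑ over triples (j, t, r) in D with j = k of t). -/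

import Mathlib

/-- Exponential ElGamal encryption: `Enc g pk m r = (g^r, g^m * pk^r)`. -/
def Enc {G : Type*} [CommGroup G] (g pk : G) (m r : ℤ) : G × G :=
  (g ^ r, g ^ m * pk ^ r)

/-- ElGamal decryption (in the exponent): `Dec sk (c1, c2) = c2 * c1^(-sk)`. -/
def Dec {G : Type*} [CommGroup G] (sk : ℤ) (ct : G × G) : G :=
  ct.2 * ct.1 ^ (-sk)

/-- Homomorphic addition of ciphertexts: componentwise multiplication. -/
def AddCt {G : Type*} [CommGroup G] (c₁ c₂ : G × G) : G × G :=
  (c₁.1 * c₂.1, c₁.2 * c₂.2)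

/-- Re-randomization: `Rerand g pk (c1, c2) r' = (c1 * g^r', c2 * pk^r')`. -/
def Rerand {G : Type*} [CommGroup G] (g pk : G) (ct : G × G) (r' : ℤ) : G × G :=
  (ct.1 * g ^ r', ct.2 * pk ^ r')

theorem dec_enc {G : Type*} [CommGroup G] (g : G) (sk m r : ℤ) :
    Dec sk (Enc g (g ^ sk) m r) = g ^ m := by
  simp only [Dec, Enc, ← zpow_mul, ← zpow_add]
  congr 1
  ring

theorem addCt_enc {G : Type*} [CommGroup G] (g pk : G) (m₁ r₁ m₂ r₂ : ℤ) :
    AddCt (Enc g pk m₁ r₁) (Enc g pk m₂ r₂) = Enc g pk (m₁ + m₂) (r₁ + r₂) := by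
  simp only [AddCt, Enc, zpow_add, mul_mul_mul_comm]

theorem delegation_sequence_correct {G : Type*} [CommGroup G] (g : G) (sk : ℤ)
    (n : ℕ) (w ρ : Fin n → ℤ) (D : List (Fin n × ℤ × (Fin n → ℤ))) :
    ∀ k : Fin n,
      Dec sk
        ((D.foldl
            (fun (L : Fin n → G × G) (d : Fin n × ℤ × (Fin n → ℤ)) =>
              fun k => AddCt (L k)
                (Enc g (g ^ sk) (if k = d.1 then d.2.1 else 0) (d.2.2 k)))
            (fun k => Enc g (g ^ sk) (w k) (ρ k))) k) =
        g ^ (w k + ((D.filter (fun d => d.1 = k)).map (fun d => d.2.1)).sum) := by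
  intro k
  induction D generalizing w ρ with
  | nil => simp [dec_enc]
  | cons d D ih =>
    simp only [List.foldl_cons, addCt_enc]
    rw [ih (fun k => w k + if k = d.1 then d.2.1 else 0) (fun k => ρ k + d.2.2 k)]
    by_cases h : d.1 = k
    · simp [h, add_assoc]
    · simp [h, Ne.symm h]
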